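/- Let α ∈ (0,1) and 0 < a ≤ b. Then ∫₀^a (b^α − x^α) · ((a − x)^{−α} − (b − x)^{−α}) dx ≤ Γ(1+α) Γ(1−α) · (b − a). -/

import Mathlib

open MeasureTheory Set

theorem intervalIntegrable_sub_rpow {r : ℝ} (hr : -1 < r) (c u v : ℝ) :
    IntervalIntegrable (fun x ↦ (c - x) ^ r) volume u v := by
  simpa using (intervalIntegral.intervalIntegrable_rpow' (a := c - u) (b := c - v) hr).comp_sub_left c

theorem integral_rpow_mul_sub_rpow_neg {α c : ℝ} (hα : α ∈ Ioo (0 : ℝ) 1) (hc : 0 < c) :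
    ∫ x in (0 : ℝ)..c, x ^ α * (c - x) ^ (-α) =
      Real.Gamma (1 + α) * Real.Gamma (1 - α) * c := by
  have h1 : 0 < 1 + α := by linarith [hα.1]
  have h2 : 0 < 1 - α := by linarith [hα.2]
  have hbeta := Complex.betaIntegral_scaled ((1 + α : ℝ) : ℂ) ((1 - α : ℝ) : ℂ) hc
  rw [Complex.betaIntegral_eq_Gamma_mul_div _ _ (by simpa using h1) (by simpa using h2),
    ← Complex.ofReal_add, Complex.Gamma_ofReal, Complex.Gamma_ofReal, Complex.Gamma_ofReal,
    show 1 + α + (1 - α) = 2 by ring, Real.Gamma_two] at hbeta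
  apply Complex.ofReal_injective
  rw [← intervalIntegral.integral_ofReal]
  calc
    _ = ∫ x in (0 : ℝ)..c, (x : ℂ) ^ (((1 + α : ℝ) : ℂ) - 1) *
          ((c : ℂ) - x) ^ (((1 - α : ℝ) : ℂ) - 1) := by
      refine intervalIntegral.integral_congr fun x hx ↦ ?_
      rw [uIcc_of_le hc.le] at hx
      simp only [Complex.ofReal_mul]
      rw [Complex.ofReal_cpow hx.1, Complex.ofReal_cpow (sub_nonneg.2 hx.2)]
      push_cast
      ring_nf
    _ = _ := by
      rw [hbeta, show ((2 : ℝ) : ℂ) - 1 = 1 by push_cast; ring, Complex.cpow_one]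
      push_cast
      ring

/-- A consequence of subadditivity of `x ↦ x ^ α`. -/
theorem rpow_mul_sub_rpow_neg_sub_le {α b x : ℝ} (hα : α ∈ Ioo (0 : ℝ) 1) (hx : 0 < x)
    (hxb : x < b) :
    b ^ α * (b - x) ^ (-α) - b ^ α * x ^ (-α) ≤ x ^ α * (b - x) ^ (-α) := by
  have hbx : 0 < b - x := sub_pos.2 hxb
  have hsub := Real.rpow_add_le_add_rpow hx.le hbx.le hα.1.le hα.2.le
  rw [add_sub_cancel] at hsub
  have hmono : x ^ α ≤ b ^ α := Real.rpow_le_rpow hx.le hxb.le hα.1.le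
  rw [Real.rpow_neg hbx.le, Real.rpow_neg hx.le]
  have hp := Real.rpow_pos_of_pos hx α
  have hq := Real.rpow_pos_of_pos hbx α
  rw [← sub_nonneg]
  have : x ^ α * ((b - x) ^ α)⁻¹ - (b ^ α * ((b - x) ^ α)⁻¹ - b ^ α * (x ^ α)⁻¹) =
      (b ^ α * (b - x) ^ α - (b ^ α - x ^ α) * x ^ α) / ((b - x) ^ α * x ^ α) := by
    field_simp
    ring
  rw [this]
  apply div_nonneg _ (by positivity)
  nlinarith

/-- For `α ∈ (0,1)` and `0 < a ≤ b`,
`∫₀^a (b^α − x^α)((a−x)^{−α} − (b−x)^{−α}) dx ≤ Γ(1+α) Γ(1−α) (b−a)`. -/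
theorem integral_rpow_diff_le (α a b : ℝ) (hα : α ∈ Set.Ioo (0:ℝ) 1) (ha : 0 < a)
    (hab : a ≤ b) :
    (∫ x in (0:ℝ)..a, (b ^ α - x ^ α) * ((a - x) ^ (-α) - (b - x) ^ (-α))) ≤
      Real.Gamma (1 + α) * Real.Gamma (1 - α) * (b - a) := by
  have hr : -1 < -α := by linarith [hα.2]
  have hS (c u v : ℝ) := intervalIntegrable_sub_rpow hr c u v
  have hP (u v : ℝ) : IntervalIntegrable (fun x : ℝ ↦ x ^ (-α)) volume u v :=
    intervalIntegral.intervalIntegrable_rpow' hr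
  have hM (c u v : ℝ) : IntervalIntegrable (fun x ↦ x ^ α * (c - x) ^ (-α)) volume u v :=
    (hS c u v).continuousOn_mul (Real.continuous_rpow_const hα.1.le).continuousOn
  have hrefl (c : ℝ) : ∫ x in (0 : ℝ)..c, (c - x) ^ (-α) = ∫ x in (0 : ℝ)..c, x ^ (-α) := by
    simpa using intervalIntegral.integral_comp_sub_left (a := 0) (b := c)
      (fun x : ℝ ↦ x ^ (-α)) c
  have hexpand : (∫ x in (0:ℝ)..a, (b ^ α - x ^ α) * ((a - x) ^ (-α) - (b - x) ^ (-α))) =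
      b ^ α * (∫ x in (0 : ℝ)..a, (a - x) ^ (-α)) - b ^ α * (∫ x in (0 : ℝ)..a, (b - x) ^ (-α)) -
        ((∫ x in (0 : ℝ)..a, x ^ α * (a - x) ^ (-α)) -
          ∫ x in (0 : ℝ)..a, x ^ α * (b - x) ^ (-α)) := by
    rw [← intervalIntegral.integral_const_mul, ← intervalIntegral.integral_const_mul,
      ← intervalIntegral.integral_sub ((hS a 0 a).const_mul _) ((hS b 0 a).const_mul _),
      ← intervalIntegral.integral_sub (hM a 0 a) (hM b 0 a),
      ← intervalIntegral.integral_sub (((hS a 0 a).const_mul _).sub ((hS b 0 a).const_mul _))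
        ((hM a 0 a).sub (hM b 0 a))]
    congr 1
    ext x
    ring
  have hS_add := intervalIntegral.integral_add_adjacent_intervals (hS b 0 a) (hS b a b)
  have hP_add := intervalIntegral.integral_add_adjacent_intervals (hP 0 a) (hP a b)
  have hM_add := intervalIntegral.integral_add_adjacent_intervals (hM b 0 a) (hM b a b)
  have htail := intervalIntegral.integral_mono_on_of_le_Ioo hab
    (((hS b a b).const_mul (b ^ α)).sub ((hP a b).const_mul (b ^ α))) (hM b a b)
    fun x hx ↦ rpow_mul_sub_rpow_neg_sub_le hα (ha.trans hx.1) hx.2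
  rw [intervalIntegral.integral_sub ((hS b a b).const_mul _) ((hP a b).const_mul _),
    intervalIntegral.integral_const_mul, intervalIntegral.integral_const_mul] at htail
  rw [integral_rpow_mul_sub_rpow_neg hα (ha.trans_le hab)] at hM_add
  rw [hexpand, integral_rpow_mul_sub_rpow_neg hα ha, hrefl]
  rw [hrefl] at hS_add
  linear_combination htail + b ^ α * hP_add - b ^ α * hS_add + hM_add
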